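/- For the AV-rule with lexicographic tie-breaking, let W ⊆ C be a committee of size k with W* ⊆ W. Then there exists a lazy-PNE A with outcome W_A = W if and only if every c ∈ W \ W* satisfies c ▷ c' for every c' ∈ C \ W. -/

import Mathlib

open Finset

/-- The 0-indexed rank of candidate `c` within committee `W` with respect to the utility `u`:
the number of members of `W` strictly preferred to `c`.  Thus the most preferred member of `W`
has rank `0`. -/
noncomputable def owaRank {C : Type*} (u : C → ℝ) (W : Finset C) (c : C) : ℕ :=
  (W.filter fun c' => u c < u c').card

/-- The OWA set-extension utility determined by the weights `lam` (where `lam 0` is the weight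
`λ₁` put on the most preferred committee member, `lam 1` is `λ₂`, and so on) and the
utility function `u`. -/
noncomputable def owaUtil {C : Type*} (lam : ℕ → ℝ) (u : C → ℝ) (W : Finset C) : ℝ :=
  ∑ c ∈ W, lam (owaRank u W c) * u c

/-- The approval score of candidate `c` under the ballot profile `A`. -/
def score {N C : Type*} [Fintype N] [DecidableEq C] (A : N → Finset C) (c : C) : ℕ :=
  (Finset.univ.filter fun i => c ∈ A i).card

/-- Candidate `c` is ranked above candidate `c'` by the best-`k` scoring rule with scoring
function `g`, with ties broken by the priority order: `c < c'` means `c` has higher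
priority (`c ▷ c'`). -/
def beats {N C : Type*} [Fintype N] [DecidableEq C] [LT C]
    (g : C → ℕ → ℝ) (A : N → Finset C) (c c' : C) : Prop :=
  g c' (score A c') < g c (score A c) ∨
    (g c (score A c) = g c' (score A c') ∧ c < c')

open Classical in
/-- The winning committee: the `k` top-ranked candidates. -/
noncomputable def winners {N C : Type*} [Fintype N] [Fintype C] [DecidableEq C] [LT C]
    (g : C → ℕ → ℝ) (k : ℕ) (A : N → Finset C) : Finset C :=
  Finset.univ.filter fun c => (Finset.univ.filter fun c' => beats g A c' c).card < k

/-- `B` is a best-response ballot of voter `i` against the other voters' ballots in `A`. -/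
def BestResponse {N C : Type*} [Fintype N] [DecidableEq N] [Fintype C] [DecidableEq C] [LT C]
    (g : C → ℕ → ℝ) (k : ℕ) (lam : ℕ → ℝ) (u : C → ℝ)
    (A : N → Finset C) (i : N) (B : Finset C) : Prop :=
  ∀ B' : Finset C,
    owaUtil lam u (winners g k (Function.update A i B')) ≤
      owaUtil lam u (winners g k (Function.update A i B))

/-- `B` is a minimal best-response ballot of voter `i`. -/
def MinimalBestResponse {N C : Type*} [Fintype N] [DecidableEq N] [Fintype C] [DecidableEq C]
    [LT C] (g : C → ℕ → ℝ) (k : ℕ) (lam : ℕ → ℝ) (u : C → ℝ)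
    (A : N → Finset C) (i : N) (B : Finset C) : Prop :=
  BestResponse g k lam u A i B ∧
    ∀ B' : Finset C, BestResponse g k lam u A i B' → B.card ≤ B'.card

/-- A ballot profile is a lazy pure Nash equilibrium if every voter's ballot is a minimal
best response to the other voters' ballots. -/
def LazyPNE {N C : Type*} [Fintype N] [DecidableEq N] [Fintype C] [DecidableEq C] [LT C]
    (g : C → ℕ → ℝ) (k : ℕ) (lam : N → ℕ → ℝ) (u : N → C → ℝ) (A : N → Finset C) : Prop :=
  ∀ i, MinimalBestResponse g k (lam i) (u i) A i (A i)

/-- A ballot is sincere if every approved candidate is preferred to every unapproved one. -/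
def Sincere {C : Type*} (u : C → ℝ) (B : Finset C) : Prop :=
  ∀ c ∈ B, ∀ c' ∉ B, u c' < u c

section StrictTotalOrder

variable {C : Type*} (R : C → C → Prop)

open Classical in
lemma card_filter_lt_card_of_rel (irr : ∀ a, ¬ R a a) (X : Finset C) {c : C} (hc : c ∈ X) :
    (X.filter fun x => R x c).card < X.card :=
  Finset.card_lt_card <| Finset.filter_ssubset.2 ⟨c, hc, irr c⟩

open Classical in
lemma card_filter_rel_lt (tr : ∀ a b c, R a b → R b c → R a c) (irr : ∀ a, ¬ R a a)
    (X : Finset C) {a b : C} (ha : a ∈ X) (hab : R a b) :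
    (X.filter fun x => R x a).card < (X.filter fun x => R x b).card := by
  apply Finset.card_lt_card
  rw [Finset.ssubset_iff_of_subset]
  · exact ⟨a, by simp [ha, hab], by simp [irr a]⟩
  · intro x hx
    simp only [Finset.mem_filter] at hx ⊢
    exact ⟨hx.1, tr _ _ _ hx.2 hab⟩

open Classical in
lemma card_filter_rel_injOn (tr : ∀ a b c, R a b → R b c → R a c) (irr : ∀ a, ¬ R a a)
    (tot : ∀ a b, a ≠ b → R a b ∨ R b a) (X : Finset C) :
    Set.InjOn (fun c => (X.filter fun x => R x c).card) X := by
  intro a ha b hb hab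
  by_contra hne
  rcases tot a b hne with h | h
  · exact (card_filter_rel_lt R tr irr X ha h).ne hab
  · exact (card_filter_rel_lt R tr irr X hb h).ne' hab

open Classical in
lemma image_card_filter_rel (tr : ∀ a b c, R a b → R b c → R a c) (irr : ∀ a, ¬ R a a)
    (tot : ∀ a b, a ≠ b → R a b ∨ R b a) (X : Finset C) :
    X.image (fun c => (X.filter fun x => R x c).card) = Finset.range X.card := by
  apply Finset.eq_of_subset_of_card_le
  · intro n hn
    obtain ⟨c, hc, rfl⟩ := Finset.mem_image.1 hn
    exact Finset.mem_range.2 (card_filter_lt_card_of_rel R irr X hc)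
  · rw [Finset.card_range, Finset.card_image_of_injOn (card_filter_rel_injOn R tr irr tot X)]

end StrictTotalOrder

section OWA

variable {C : Type*} {u : C → ℝ}

lemma owaRank_injOn (hu : Function.Injective u) (X : Finset C) :
    Set.InjOn (owaRank u X) X := by
  have h := card_filter_rel_injOn (fun a b => u b < u a) (fun _ _ _ h h' => h'.trans h)
    (fun _ => lt_irrefl _) (fun a b hab => (lt_or_gt_of_ne (hu.ne hab)).symm) X
  intro a ha b hb hab
  apply h ha hb
  simp only [owaRank] at hab
  convert hab

lemma image_owaRank (hu : Function.Injective u) (X : Finset C) :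
    X.image (owaRank u X) = Finset.range X.card := by
  have h := image_card_filter_rel (fun a b => u b < u a) (fun _ _ _ h h' => h'.trans h)
    (fun _ => lt_irrefl _) (fun a b hab => (lt_or_gt_of_ne (hu.ne hab)).symm) X
  rw [← h]
  congr 1

lemma exists_owaRank_eq (hu : Function.Injective u) (X : Finset C) {n : ℕ} (hn : n < X.card) :
    ∃ c ∈ X, owaRank u X c = n := by
  have : n ∈ X.image (owaRank u X) := by rw [image_owaRank hu]; simpa using hn
  simpa using this

/-- Transporting the OWA utility of `X` along an equal-rank map from a committee `Y` of the
same size. -/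
lemma exists_owaUtil_eq_sum (hu : Function.Injective u) (lam : ℕ → ℝ) {X Y : Finset C}
    (hXY : X.card = Y.card) :
    ∃ e : C → C, (∀ c ∈ Y, e c ∈ X ∧ owaRank u X (e c) = owaRank u Y c) ∧
      owaUtil lam u X = ∑ c ∈ Y, lam (owaRank u Y c) * u (e c) := by
  have h : ∀ c, ∃ x, c ∈ Y → x ∈ X ∧ owaRank u X x = owaRank u Y c := by
    intro c
    by_cases hc : c ∈ Y
    · have : owaRank u Y c ∈ Y.image (owaRank u Y) := Finset.mem_image_of_mem _ hc
      rw [image_owaRank hu, Finset.mem_range, ← hXY] at this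
      obtain ⟨x, hx⟩ := exists_owaRank_eq hu X this
      exact ⟨x, fun _ => hx⟩
    · exact ⟨c, fun h => absurd h hc⟩
  choose e he using h
  refine ⟨e, he, ?_⟩
  symm
  apply Finset.sum_bij (fun c _ => e c)
  · exact fun c hc => (he c hc).1
  · intro a ha b hb hab
    apply owaRank_injOn hu Y ha hb
    rw [← (he a ha).2, ← (he b hb).2, hab]
  · intro x hx
    have : owaRank u X x ∈ X.image (owaRank u X) := Finset.mem_image_of_mem _ hx
    rw [image_owaRank hu, Finset.mem_range, hXY] at this
    obtain ⟨c, hc, hcx⟩ := exists_owaRank_eq hu Y this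
    exact ⟨c, hc, owaRank_injOn hu X (he c hc).1 hx ((he c hc).2.trans hcx)⟩
  · intro c hc
    rw [(he c hc).2]

variable {S X Y : Finset C}

lemma mem_top_of_le (hS : ∀ c ∈ S, ∀ c' ∉ S, u c' < u c) {c x : C} (hc : c ∈ S)
    (h : u c ≤ u x) : x ∈ S := by
  by_contra hx
  exact absurd (hS c hc x hx) (not_lt.2 h)

lemma mem_top_of_owaRank_lt (hS : ∀ c ∈ S, ∀ c' ∉ S, u c' < u c) (hSY : S ⊆ Y) {c : C}
    (hc : owaRank u Y c < S.card) : c ∈ S := by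
  by_contra h
  refine hc.not_ge (Finset.card_le_card fun s hs => ?_)
  simp only [Finset.mem_filter]
  exact ⟨hSY hs, hS s hs c h⟩

lemma card_filter_le_eq_owaRank_add_one (hu : Function.Injective u) {x : C} (hx : x ∈ X) :
    (X.filter fun y => u x ≤ u y).card = owaRank u X x + 1 := by
  classical
  have : (X.filter fun y => u x ≤ u y) = insert x (X.filter fun y => u x < u y) := by
    ext y
    simp only [Finset.mem_filter, Finset.mem_insert, le_iff_lt_or_eq]
    constructor
    · rintro ⟨h, h' | h'⟩
      · exact Or.inr ⟨h, h'⟩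
      · exact Or.inl (hu h').symm
    · rintro (rfl | h)
      · exact ⟨hx, Or.inr rfl⟩
      · exact ⟨h.1, Or.inl h.2⟩
  rw [this, Finset.card_insert_of_notMem (by simp), owaRank]

lemma le_of_owaRank_eq (hu : Function.Injective u) (hS : ∀ c ∈ S, ∀ c' ∉ S, u c' < u c)
    (hSY : S ⊆ Y) {c x : C} (hc : c ∈ S) (hx : x ∈ X)
    (h : owaRank u X x = owaRank u Y c) : u x ≤ u c := by
  by_contra! hlt
  have h1 := card_filter_le_eq_owaRank_add_one hu hx
  have h2 : (X.filter fun y => u x ≤ u y).card ≤ owaRank u Y c := by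
    apply Finset.card_le_card
    intro y hy
    simp only [Finset.mem_filter] at hy ⊢
    have := hlt.trans_le hy.2
    exact ⟨hSY (mem_top_of_le hS hc this.le), this⟩
  omega

/-- A committee containing the top set `S`, outside of which the weights vanish, maximises the
OWA utility among committees of its size. -/
lemma owaUtil_le_of_top_subset (hu : Function.Injective u) {lam : ℕ → ℝ} (hlam : ∀ n, 0 ≤ lam n)
    (hz : ∀ n, S.card ≤ n → lam n = 0) (hS : ∀ c ∈ S, ∀ c' ∉ S, u c' < u c)
    (hSY : S ⊆ Y) (hXY : X.card = Y.card) : owaUtil lam u X ≤ owaUtil lam u Y := by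
  obtain ⟨e, he, hsum⟩ := exists_owaUtil_eq_sum hu lam hXY
  rw [hsum, owaUtil]
  apply Finset.sum_le_sum
  intro c hc
  by_cases h : owaRank u Y c < S.card
  · exact mul_le_mul_of_nonneg_left (le_of_owaRank_eq hu hS hSY (mem_top_of_owaRank_lt hS hSY h)
      (he c hc).1 (he c hc).2) (hlam _)
  · simp [hz _ (not_lt.1 h)]

/-- If the last weight on the top set `S` is positive, every optimal committee contains `S`. -/
lemma top_subset_of_owaUtil_le (hu : Function.Injective u) {lam : ℕ → ℝ} (hlam : ∀ n, 0 ≤ lam n)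
    (hz : ∀ n, S.card ≤ n → lam n = 0) (hS0 : 1 ≤ S.card) (hpos : 0 < lam (S.card - 1))
    (hS : ∀ c ∈ S, ∀ c' ∉ S, u c' < u c)
    (hSY : S ⊆ Y) (hXY : X.card = Y.card) (hle : owaUtil lam u Y ≤ owaUtil lam u X) :
    S ⊆ X := by
  obtain ⟨e, he, hsum⟩ := exists_owaUtil_eq_sum hu lam hXY
  have hterm : ∀ c ∈ Y, lam (owaRank u Y c) * u (e c) ≤ lam (owaRank u Y c) * u c := by
    intro c hc
    by_cases h : owaRank u Y c < S.card
    · exact mul_le_mul_of_nonneg_left (le_of_owaRank_eq hu hS hSY (mem_top_of_owaRank_lt hS hSY h)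
        (he c hc).1 (he c hc).2) (hlam _)
    · simp [hz _ (not_lt.1 h)]
  have heq : ∑ c ∈ Y, lam (owaRank u Y c) * u (e c) = ∑ c ∈ Y, lam (owaRank u Y c) * u c :=
    le_antisymm (Finset.sum_le_sum hterm) (by rw [← hsum]; exact hle)
  rw [Finset.sum_eq_sum_iff_of_le hterm] at heq
  have hcard := Finset.card_le_card hSY
  obtain ⟨c, hcY, hc⟩ := exists_owaRank_eq hu Y (n := S.card - 1) (by omega)
  have hcS : c ∈ S := mem_top_of_owaRank_lt hS hSY (by omega)
  have hce : e c = c := hu (mul_left_cancel₀ (by rw [hc]; exact hpos.ne') (heq c hcY))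
  obtain ⟨hcX, hrank⟩ := he c hcY
  rw [hce] at hcX hrank
  have h1 := card_filter_le_eq_owaRank_add_one hu hcX
  have h2 : (X.filter fun y => u c ≤ u y) = S := by
    apply Finset.eq_of_subset_of_card_le
    · intro y hy
      exact mem_top_of_le hS hcS (Finset.mem_filter.1 hy).2
    · omega
  rw [← h2]
  exact Finset.filter_subset _ _

end OWA

section Approval

variable {N C : Type*} [Fintype N]

lemma beats_approval_iff [DecidableEq C] [LT C] (A : N → Finset C) (c c' : C) :
    beats (fun _ n => (n : ℝ)) A c c' ↔
      score A c' < score A c ∨ (score A c = score A c' ∧ c < c') := by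
  simp [beats]

variable [LinearOrder C]

lemma score_eq_zero_iff {A : N → Finset C} {c : C} : score A c = 0 ↔ ∀ i, c ∉ A i := by
  simp [score, Finset.filter_eq_empty_iff]

lemma score_pos_of_mem {A : N → Finset C} {c : C} {i : N} (h : c ∈ A i) : 0 < score A c :=
  Nat.pos_of_ne_zero fun h0 => score_eq_zero_iff.1 h0 i h

lemma beats_approval_trans (A : N → Finset C) (a b c : C)
    (hab : beats (fun _ n => (n : ℝ)) A a b) (hbc : beats (fun _ n => (n : ℝ)) A b c) :
    beats (fun _ n => (n : ℝ)) A a c := by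
  rw [beats_approval_iff] at *
  rcases hab with h | ⟨h, h'⟩ <;> rcases hbc with k | ⟨k, k'⟩
  · left; omega
  · left; omega
  · left; omega
  · right; exact ⟨h.trans k, h'.trans k'⟩

lemma beats_approval_irrefl (A : N → Finset C) (a : C) :
    ¬ beats (fun _ n => (n : ℝ)) A a a := by
  simp [beats_approval_iff]

lemma beats_approval_total (A : N → Finset C) (a b : C) (hab : a ≠ b) :
    beats (fun _ n => (n : ℝ)) A a b ∨ beats (fun _ n => (n : ℝ)) A b a := by
  simp only [beats_approval_iff]
  rcases lt_trichotomy (score A a) (score A b) with h | h | h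
  · exact Or.inr (Or.inl h)
  · rcases lt_or_gt_of_ne hab with h' | h'
    · exact Or.inl (Or.inr ⟨h, h'⟩)
    · exact Or.inr (Or.inr ⟨h.symm, h'⟩)
  · exact Or.inl (Or.inl h)

variable [Fintype C]

open Classical in
lemma mem_winners {k : ℕ} {A : N → Finset C} {c : C} :
    c ∈ winners (fun _ n => (n : ℝ)) k A ↔
      (Finset.univ.filter fun c' => beats (fun _ n => (n : ℝ)) A c' c).card < k := by
  simp [winners]

lemma card_winners {k : ℕ} (hk : k ≤ Fintype.card C) (A : N → Finset C) :
    (winners (fun _ n => (n : ℝ)) k A).card = k := by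
  classical
  have hinj := card_filter_rel_injOn (beats (fun _ n => (n : ℝ)) A) (beats_approval_trans A)
    (beats_approval_irrefl A) (beats_approval_total A) Finset.univ
  have himg := image_card_filter_rel (beats (fun _ n => (n : ℝ)) A) (beats_approval_trans A)
    (beats_approval_irrefl A) (beats_approval_total A) Finset.univ
  rw [← Finset.card_image_of_injOn (hinj.mono (Finset.coe_subset.2 (Finset.subset_univ _)))]
  conv_rhs => rw [← Finset.card_range k]
  congr 1
  ext n
  simp only [Finset.mem_image, mem_winners, Finset.mem_range]
  constructor
  · rintro ⟨c, hc, rfl⟩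
    exact hc
  · intro hn
    have : n ∈ Finset.range (Finset.univ : Finset C).card := by
      rw [Finset.mem_range, Finset.card_univ]; omega
    rw [← himg, Finset.mem_image] at this
    obtain ⟨c, -, hc⟩ := this
    exact ⟨c, by rw [hc]; exact hn, hc⟩

lemma mem_winners_of_beats {k : ℕ} {A : N → Finset C} {c d : C}
    (hc : c ∈ winners (fun _ n => (n : ℝ)) k A) (hd : beats (fun _ n => (n : ℝ)) A d c) :
    d ∈ winners (fun _ n => (n : ℝ)) k A := by
  classical
  rw [mem_winners] at hc ⊢
  exact (card_filter_rel_lt _ (beats_approval_trans A) (beats_approval_irrefl A) _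
    (Finset.mem_univ d) hd).trans hc

lemma beats_of_mem_winners {k : ℕ} {A : N → Finset C} {c d : C}
    (hc : c ∈ winners (fun _ n => (n : ℝ)) k A) (hd : d ∉ winners (fun _ n => (n : ℝ)) k A) :
    beats (fun _ n => (n : ℝ)) A c d := by
  rcases beats_approval_total A c d (fun h => hd (h ▸ hc)) with h | h
  · exact h
  · exact absurd (mem_winners_of_beats hc h) hd

lemma winners_eq_of_beats {k : ℕ} {A : N → Finset C} {W : Finset C} (hW : W.card = k)
    (h : ∀ c ∈ W, ∀ d ∉ W, beats (fun _ n => (n : ℝ)) A c d) :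
    winners (fun _ n => (n : ℝ)) k A = W := by
  classical
  ext c
  rw [mem_winners]
  constructor
  · intro hc
    by_contra hcW
    refine hc.not_ge (hW ▸ Finset.card_le_card fun w hw => ?_)
    simpa using h w hw c hcW
  · intro hc
    rw [← hW]
    apply Finset.card_lt_card
    rw [Finset.ssubset_iff_of_subset]
    · exact ⟨c, hc, by simp [beats_approval_irrefl]⟩
    · intro d hd
      by_contra hdW
      exact beats_approval_irrefl A c
        (beats_approval_trans A _ _ _ (h c hc d hdW) (by simpa using hd))

/-- Withdrawing approval from `d` does not hurt any other winner. -/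
lemma mem_winners_update_erase [DecidableEq N] {k : ℕ} {A : N → Finset C} (i : N) {c d : C}
    (hcd : c ≠ d) (hc : c ∈ winners (fun _ n => (n : ℝ)) k A) :
    c ∈ winners (fun _ n => (n : ℝ)) k (Function.update A i ((A i).erase d)) := by
  classical
  have hne : ∀ x, x ≠ d → score (Function.update A i ((A i).erase d)) x = score A x := by
    intro x hx
    unfold score
    congr 1
    ext j
    by_cases hj : j = i
    · subst hj; simp [hx]
    · simp [Function.update_of_ne hj]
  have hle : ∀ x, score (Function.update A i ((A i).erase d)) x ≤ score A x := by
    intro x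
    apply Finset.card_le_card
    intro j
    by_cases hj : j = i
    · subst hj; simp
    · simp [Function.update_of_ne hj]
  rw [mem_winners] at hc ⊢
  refine (Finset.card_le_card fun x hx => ?_).trans_lt hc
  simp only [Finset.mem_filter, Finset.mem_univ, true_and, beats_approval_iff, hne c hcd] at hx ⊢
  have := hle x
  rcases hx with h | ⟨h, h'⟩
  · left; omega
  · rcases this.lt_or_eq with h2 | h2
    · left; omega
    · right; exact ⟨h2.symm.trans h, h'⟩

end Approval

/-- for a committee `W` of size `k` with `W* ⊆ W`, a lazy-PNE with outcome `W`
exists iff every candidate of `W \ W*` has higher priority than every candidate outside `W`. -/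
theorem statement_12 {N C : Type*} [Fintype N] [DecidableEq N] [Fintype C] [LinearOrder C]
    (k : ℕ) (hk1 : 1 ≤ k) (hk2 : k ≤ Fintype.card C)
    (u : N → C → ℝ) (hu : ∀ i, Function.Injective (u i))
    (lam : N → ℕ → ℝ) (hlam : ∀ i n, 0 ≤ lam i n)
    (jstar : N → ℕ) (hj1 : ∀ i, 1 ≤ jstar i) (hjk : ∀ i, jstar i ≤ k)
    (hz : ∀ i n, jstar i ≤ n → lam i n = 0)
    (hpos : ∀ i, 0 < lam i (jstar i - 1))
    (Wst : N → Finset C) (hWstcard : ∀ i, (Wst i).card = jstar i)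
    (hWsttop : ∀ i, ∀ c ∈ Wst i, ∀ c' ∉ Wst i, u i c' < u i c)
    (W : Finset C) (hW : W.card = k)
    (hWstar : Finset.univ.biUnion Wst ⊆ W) :
    (∃ A : N → Finset C, LazyPNE (fun _ n => (n : ℝ)) k lam u A ∧
        winners (fun _ n => (n : ℝ)) k A = W) ↔
      ∀ c ∈ W \ Finset.univ.biUnion Wst, ∀ c' ∉ W, c < c' := by
  classical
  have hsub : ∀ i, Wst i ⊆ W := fun i =>
    (Finset.subset_biUnion_of_mem Wst (Finset.mem_univ i)).trans hWstar
  have hz' : ∀ i n, (Wst i).card ≤ n → lam i n = 0 := fun i n h => hz i n (hWstcard i ▸ h)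
  have hmax : ∀ i (A : N → Finset C) (Y : Finset C), Wst i ⊆ Y → Y.card = k →
      owaUtil (lam i) (u i) (winners (fun _ n => (n : ℝ)) k A) ≤ owaUtil (lam i) (u i) Y :=
    fun i A Y hY hYk => owaUtil_le_of_top_subset (hu i) (hlam i) (hz' i) (hWsttop i) hY
      ((card_winners hk2 A).trans hYk.symm)
  constructor
  · rintro ⟨A, hA, hAW⟩ c hc c' hc'
    have hAsub : ∀ i, A i ⊆ Wst i := by
      intro i d hd
      by_contra hdW
      have hBR : BestResponse (fun _ n => (n : ℝ)) k (lam i) (u i) A i ((A i).erase d) := by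
        intro B'
        refine hmax i _ _ (fun x hx => ?_) (card_winners hk2 _)
        exact mem_winners_update_erase i (fun h => hdW (h ▸ hx)) (hAW ▸ hsub i hx)
      have := (hA i).2 _ hBR
      exact absurd (Finset.card_erase_lt_of_mem hd) (not_lt.2 this)
    have hzero : ∀ x, x ∉ Finset.univ.biUnion Wst → score A x = 0 := by
      intro x hx
      rw [score_eq_zero_iff]
      exact fun i hi => hx (Finset.mem_biUnion.2 ⟨i, Finset.mem_univ i, hAsub i hi⟩)
    rw [Finset.mem_sdiff] at hc
    have hb := beats_of_mem_winners (A := A) (k := k) (hAW ▸ hc.1) (by rwa [hAW] : c' ∉ _)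
    rw [beats_approval_iff, hzero c hc.2, hzero c' fun h => hc' (hWstar h)] at hb
    simpa using hb
  · intro h
    have hrep : ∀ c, ∃ P : N → Prop, (∀ i j, P i → P j → i = j) ∧ (∀ i, P i → c ∈ Wst i) ∧
        (c ∈ Finset.univ.biUnion Wst → ∃ i, P i) := by
      intro c
      by_cases hc : c ∈ Finset.univ.biUnion Wst
      · obtain ⟨i, -, hi⟩ := Finset.mem_biUnion.1 hc
        exact ⟨fun j => j = i, fun _ _ h h' => h.trans h'.symm, fun _ h => h ▸ hi,
          fun _ => ⟨i, rfl⟩⟩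
      · exact ⟨fun _ => False, by simp, by simp, fun h => absurd h hc⟩
    choose P hPuniq hPmem hPex using hrep
    have hbad : ∀ c ∈ W, (∃ c' ∉ W, c' < c) → ∃ i, P c i := by
      rintro c hc ⟨c', hc', hlt⟩
      apply hPex
      by_contra hcs
      exact lt_asymm hlt (h c (Finset.mem_sdiff.2 ⟨hc, hcs⟩) c' hc')
    obtain ⟨A, hAmem⟩ : ∃ A : N → Finset C,
        ∀ i c, c ∈ A i ↔ c ∈ W ∧ (∃ c' ∉ W, c' < c) ∧ P c i :=
      ⟨fun i => Finset.univ.filter fun c => c ∈ W ∧ (∃ c' ∉ W, c' < c) ∧ P c i, by simp⟩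
    have hAW : winners (fun _ n => (n : ℝ)) k A = W := by
      apply winners_eq_of_beats hW
      intro c hc d hd
      have hd0 : score A d = 0 := score_eq_zero_iff.2 fun i hi => hd ((hAmem i d).1 hi).1
      rw [beats_approval_iff, hd0]
      by_cases hcb : ∃ c' ∉ W, c' < c
      · obtain ⟨i, hi⟩ := hbad c hc hcb
        exact Or.inl (score_pos_of_mem ((hAmem i c).2 ⟨hc, hcb, hi⟩))
      · push Not at hcb
        rcases Nat.eq_zero_or_pos (score A c) with h0 | h0
        · exact Or.inr ⟨h0, (hcb d hd).lt_of_ne fun e => hd (e ▸ hc)⟩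
        · exact Or.inl h0
    refine ⟨A, fun i => ⟨fun B' => ?_, fun B' hB' => Finset.card_le_card fun c hc => ?_⟩, hAW⟩
    · rw [Function.update_eq_self, hAW]
      exact hmax i _ W (hsub i) hW
    · by_contra hcB
      have hWB : Wst i ⊆ winners (fun _ n => (n : ℝ)) k (Function.update A i B') := by
        refine top_subset_of_owaUtil_le (hu i) (hlam i) (hz' i) (by rw [hWstcard]; exact hj1 i)
          (by rw [hWstcard]; exact hpos i) (hWsttop i) (hsub i)
          ((card_winners hk2 _).trans hW.symm) ?_
        have := hB' (A i)
        rwa [Function.update_eq_self, hAW] at this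
      obtain ⟨hcW, ⟨c', hc', hlt⟩, hci⟩ := (hAmem i c).1 hc
      have hc0 : score (Function.update A i B') c = 0 := by
        rw [score_eq_zero_iff]
        intro j
        by_cases hj : j = i
        · subst hj; simpa using hcB
        · rw [Function.update_of_ne hj, hAmem]
          exact fun hjc => hj (hPuniq c _ _ hjc.2.2 hci)
      have hcwin := hWB (hPmem c i hci)
      have hc'win : c' ∈ winners (fun _ n => (n : ℝ)) k (Function.update A i B') := by
        apply mem_winners_of_beats hcwin
        rw [beats_approval_iff, hc0]
        rcases Nat.eq_zero_or_pos (score (Function.update A i B') c') with h0 | h0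
        · exact Or.inr ⟨h0, hlt⟩
        · exact Or.inl h0
      obtain ⟨w, hwW, hw⟩ : ∃ w ∈ W,
          w ∉ winners (fun _ n => (n : ℝ)) k (Function.update A i B') := by
        by_contra! hall
        have := Finset.eq_of_subset_of_card_le (fun w hw => hall w hw)
          ((card_winners hk2 _).trans hW.symm).le
        exact hc' (this ▸ hc'win)
      have hb := beats_of_mem_winners hcwin hw
      rw [beats_approval_iff, hc0] at hb
      rcases hb with hb | ⟨hw0, hcw⟩
      · omega
      · have hwb : ∃ c' ∉ W, c' < w := ⟨c', hc', hlt.trans hcw⟩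
        obtain ⟨j, hj⟩ := hbad w hwW hwb
        by_cases hji : j = i
        · exact hw (hWB (hPmem w i (hji ▸ hj)))
        · have := score_eq_zero_iff.1 hw0.symm j
          rw [Function.update_of_ne hji] at this
          exact this ((hAmem j w).2 ⟨hwW, hwb, hj⟩)
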